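/- Fix β > 0, λ ≥ 0, η ∈ (0,1), and a closed set U ⊆ [η,1] × ℝ³. For each α < ∞, the set Ξ(α) = {(ρ, y) ∈ P × ℝ : (Q(ρ), M(ρ), A(ρ), E(ρ)) ∈ U and J(ρ, y) ≥ −α} is closed in P × ℝ. -/

import Mathlib

open MeasureTheory ProbabilityTheory Real Filter
open scoped ENNReal NNReal

noncomputable section

/-- The open interval `(−1,1)` as a type. -/
abbrev Int11 : Type := ↥(Set.Ioo (-1 : ℝ) 1)

/-- Inverse hyperbolic tangent. -/
def atanh (x : ℝ) : ℝ := Real.log ((1 + x) / (1 - x)) / 2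

/-- Binary entropy function. -/
def ent (m : ℝ) : ℝ :=
  -((1 + m) / 2) * Real.log ((1 + m) / 2) - ((1 - m) / 2) * Real.log ((1 - m) / 2)

/-- `Q(ρ) = ∫ x² ρ(dx)`. -/
def Qm (ρ : ProbabilityMeasure Int11) : ℝ := ∫ x, (x : ℝ) ^ 2 ∂(ρ : Measure Int11)

/-- `M(ρ) = ∫ x ρ(dx)`. -/
def Mm (ρ : ProbabilityMeasure Int11) : ℝ := ∫ x, (x : ℝ) ∂(ρ : Measure Int11)

/-- `A(ρ) = ∫ x arctanh(x) ρ(dx)`. -/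
def Am (ρ : ProbabilityMeasure Int11) : ℝ :=
  ∫ x, (x : ℝ) * atanh (x : ℝ) ∂(ρ : Measure Int11)

/-- `E(ρ) = −∫ [h(x) + (1/2)x arctanh(x)] ρ(dx) − (β²/4)(1 − Q(ρ)²)`. -/
def Em (β : ℝ) (ρ : ProbabilityMeasure Int11) : ℝ :=
  -∫ x, (ent (x : ℝ) + (x : ℝ) * atanh (x : ℝ) / 2) ∂(ρ : Measure Int11)
    - β ^ 2 / 4 * (1 - (Qm ρ) ^ 2)

/-- `g(x; φ, q, y)`. -/
def gdens (β lam x φ q y : ℝ) : ℝ :=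
  (1 - x ^ 2)⁻¹ *
    Real.exp (-(atanh x - β * lam * φ + β ^ 2 * (1 - q) * x - y * x) ^ 2 / (2 * β ^ 2 * q))

/-- The extended-real functional `J(ρ,y)`. -/
def JE (β lam : ℝ) (ρ : ProbabilityMeasure Int11) (y : ℝ) : EReal :=
  ((β ^ 2 * (1 - Qm ρ) ^ 2 / 2 - Real.log (2 * π * β ^ 2 * Qm ρ) / 2 : ℝ) : EReal)
  + ((∫⁻ x, ENNReal.ofReal (Real.log (gdens β lam x (Mm ρ) (Qm ρ) y))
        ∂(ρ : Measure Int11) : ℝ≥0∞) : EReal)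
  - ((∫⁻ x, ENNReal.ofReal (-Real.log (gdens β lam x (Mm ρ) (Qm ρ) y))
        ∂(ρ : Measure Int11) : ℝ≥0∞) : EReal)

section WeakConvergence

variable {X ι : Type*} [TopologicalSpace X] [MeasurableSpace X] [BorelSpace X]
  {F : Filter ι} {μs : ι → ProbabilityMeasure X} {μ : ProbabilityMeasure X}

/-- Integrals of bounded continuous functions converge under weak convergence. -/
lemma tendsto_integral_of_bounded (hμ : Tendsto μs F (nhds μ)) {f : X → ℝ} (hf : Continuous f)
    (C : ℝ) (hC : ∀ x, |f x| ≤ C) :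
    Tendsto (fun i ↦ ∫ x, f x ∂(μs i : Measure X)) F (nhds (∫ x, f x ∂(μ : Measure X))) :=
  ProbabilityMeasure.tendsto_iff_forall_integral_tendsto.1 hμ
    (BoundedContinuousFunction.ofNormedAddCommGroup f hf C hC)

/-- An eventual bound on the integral of a nonnegative continuous function passes to a weak
limit. -/
lemma integrable_and_integral_le_of_tendsto [F.NeBot] (hμ : Tendsto μs F (nhds μ)) {g : X → ℝ}
    (hg : Continuous g) (hg0 : ∀ x, 0 ≤ g x) {K : ℝ}
    (hK : ∀ᶠ i in F, Integrable g (μs i : Measure X) ∧ ∫ x, g x ∂(μs i : Measure X) ≤ K) :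
    Integrable g (μ : Measure X) ∧ ∫ x, g x ∂(μ : Measure X) ≤ K := by
  have hK0 : 0 ≤ K := by
    obtain ⟨i, -, hi⟩ := hK.exists
    exact (integral_nonneg hg0).trans hi
  have hmin0 (n : ℕ) (x : X) : 0 ≤ min (g x) n := le_min (hg0 x) n.cast_nonneg
  have hcont (n : ℕ) : Continuous fun x ↦ min (g x) (n : ℝ) := hg.min continuous_const
  have hbd (n : ℕ) (x : X) : |min (g x) (n : ℝ)| ≤ n := by
    rw [abs_of_nonneg (hmin0 n x)]
    exact min_le_right _ _
  have hint (ν : ProbabilityMeasure X) (n : ℕ) :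
      Integrable (fun x ↦ min (g x) (n : ℝ)) (ν : Measure X) :=
    Integrable.of_bound (hcont n).aestronglyMeasurable n (ae_of_all _ (hbd n))
  have htrunc (n : ℕ) : ∫ x, min (g x) (n : ℝ) ∂(μ : Measure X) ≤ K := by
    refine le_of_tendsto (tendsto_integral_of_bounded hμ (hcont n) n (hbd n)) ?_
    filter_upwards [hK] with i hi
    exact (integral_mono (hint _ n) hi.1 fun x ↦ min_le_left _ _).trans hi.2
  have hlim (x : X) : Tendsto (fun n : ℕ ↦ ENNReal.ofReal (min (g x) n)) atTop
      (nhds (ENNReal.ofReal (g x))) := by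
    refine tendsto_const_nhds.congr' ?_
    filter_upwards [eventually_ge_atTop ⌈g x⌉₊] with n hn
    rw [min_eq_left (Nat.ceil_le.1 hn)]
  have hl : ∫⁻ x, ENNReal.ofReal (g x) ∂(μ : Measure X) ≤ ENNReal.ofReal K := by
    calc ∫⁻ x, ENNReal.ofReal (g x) ∂(μ : Measure X)
        = ∫⁻ x, liminf (fun n : ℕ ↦ ENNReal.ofReal (min (g x) n)) atTop ∂(μ : Measure X) :=
          lintegral_congr fun x ↦ (hlim x).liminf_eq.symm
      _ ≤ liminf (fun n : ℕ ↦ ∫⁻ x, ENNReal.ofReal (min (g x) n) ∂(μ : Measure X)) atTop :=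
          lintegral_liminf_le fun n ↦ (hcont n).measurable.ennreal_ofReal
      _ ≤ liminf (fun _ : ℕ ↦ ENNReal.ofReal K) atTop := by
          refine liminf_le_liminf (Eventually.of_forall fun n ↦ ?_)
          rw [← ofReal_integral_eq_lintegral_ofReal (hint μ n) (ae_of_all _ (hmin0 n))]
          exact ENNReal.ofReal_le_ofReal (htrunc n)
      _ = ENNReal.ofReal K := liminf_const _
  have hgi : Integrable g (μ : Measure X) := by
    refine ⟨hg.aestronglyMeasurable, ?_⟩
    rw [hasFiniteIntegral_iff_ofReal (ae_of_all _ hg0)]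
    exact hl.trans_lt ENNReal.ofReal_lt_top
  refine ⟨hgi, ?_⟩
  rwa [← ofReal_integral_eq_lintegral_ofReal hgi (ae_of_all _ hg0),
    ENNReal.ofReal_le_ofReal_iff hK0] at hl

lemma integrable_of_integrable_sq (ν : ProbabilityMeasure X) {f : X → ℝ} (hf : Continuous f)
    (h : Integrable (fun x ↦ f x ^ 2) (ν : Measure X)) : Integrable f (ν : Measure X) := by
  refine ((integrable_const (1 : ℝ)).add h).mono' hf.aestronglyMeasurable (ae_of_all _ fun x ↦ ?_)
  simp only [Real.norm_eq_abs, Pi.add_apply]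
  nlinarith [sq_abs (f x), sq_nonneg (|f x| - 1), abs_nonneg (f x)]

lemma abs_sub_truncation_le (t : ℝ) {R : ℝ} (hR : 0 < R) :
    |t - max (-R) (min t R)| ≤ t ^ 2 / R := by
  rw [le_div_iff₀ hR]
  rcases le_total t R with h | h
  · rw [min_eq_left h]
    rcases le_total (-R) t with h' | h'
    · rw [max_eq_right h']
      simpa using sq_nonneg t
    · rw [max_eq_left h', abs_of_nonpos (by linarith)]
      nlinarith
  · rw [min_eq_right h, max_eq_right (by linarith), abs_of_nonneg (by linarith)]
    nlinarith

lemma abs_integral_sub_truncation_le (ν : ProbabilityMeasure X) {f : X → ℝ} (hf : Continuous f)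
    {K R : ℝ} (hR : 0 < R) (h : Integrable (fun x ↦ f x ^ 2) (ν : Measure X))
    (hK : ∫ x, f x ^ 2 ∂(ν : Measure X) ≤ K) :
    |∫ x, f x ∂(ν : Measure X) - ∫ x, max (-R) (min (f x) R) ∂(ν : Measure X)| ≤ K / R := by
  have hti : Integrable (fun x ↦ max (-R) (min (f x) R)) (ν : Measure X) := by
    refine Integrable.of_bound (by fun_prop) R (ae_of_all _ fun x ↦ abs_le.2 ⟨le_max_left _ _, ?_⟩)
    exact max_le (by linarith) (min_le_right _ _)
  have hfi := integrable_of_integrable_sq ν hf h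
  rw [← integral_sub hfi hti]
  calc |∫ x, (f x - max (-R) (min (f x) R)) ∂(ν : Measure X)|
      ≤ ∫ x, |f x - max (-R) (min (f x) R)| ∂(ν : Measure X) := abs_integral_le_integral_abs
    _ ≤ ∫ x, f x ^ 2 / R ∂(ν : Measure X) :=
        integral_mono (hfi.sub hti).abs (h.div_const R) fun x ↦ abs_sub_truncation_le _ hR
    _ ≤ K / R := by
        rw [integral_div]
        gcongr

/-- Integrals of a continuous function with eventually bounded second moments converge under weak
convergence. -/
lemma tendsto_integral_of_sq_bounded [F.NeBot] (hμ : Tendsto μs F (nhds μ)) {f : X → ℝ}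
    (hf : Continuous f) {K : ℝ}
    (hK : ∀ᶠ i in F, Integrable (fun x ↦ f x ^ 2) (μs i : Measure X) ∧
      ∫ x, f x ^ 2 ∂(μs i : Measure X) ≤ K) :
    Tendsto (fun i ↦ ∫ x, f x ∂(μs i : Measure X)) F (nhds (∫ x, f x ∂(μ : Measure X))) := by
  have hlim := integrable_and_integral_le_of_tendsto hμ (hf.pow 2) (fun x ↦ sq_nonneg (f x)) hK
  have hK0 : 0 ≤ K := (integral_nonneg fun x ↦ sq_nonneg (f x)).trans hlim.2
  rw [Metric.tendsto_nhds]
  intro ε hε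
  set R : ℝ := 3 * (K + 1) / ε with hRdef
  have hR : 0 < R := by positivity
  have hKR : K / R < ε / 3 := by
    rw [div_lt_iff₀ hR, hRdef]
    field_simp
    linarith
  have ht : Tendsto (fun i ↦ ∫ x, max (-R) (min (f x) R) ∂(μs i : Measure X)) F
      (nhds (∫ x, max (-R) (min (f x) R) ∂(μ : Measure X))) := by
    refine tendsto_integral_of_bounded hμ (by fun_prop) R fun x ↦ abs_le.2 ⟨le_max_left _ _, ?_⟩
    exact max_le (by linarith) (min_le_right _ _)
  have h0 := abs_le.1 (abs_integral_sub_truncation_le μ hf hR hlim.1 hlim.2)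
  filter_upwards [hK, Metric.tendsto_nhds.1 ht (ε / 3) (by positivity)] with i hi hti
  have h1 := abs_le.1 (abs_integral_sub_truncation_le (μs i) hf hR hi.1 hi.2)
  rw [Real.dist_eq, abs_lt] at hti ⊢
  constructor <;> linarith [h0.1, h0.2, h1.1, h1.2, hti.1, hti.2]

end WeakConvergence

section Hyperbolic

lemma Int11.one_add_pos (x : Int11) : 0 < 1 + (x : ℝ) := by linarith [x.2.1]

lemma Int11.one_sub_pos (x : Int11) : 0 < 1 - (x : ℝ) := by linarith [x.2.2]

lemma Int11.abs_le_one (x : Int11) : |(x : ℝ)| ≤ 1 := abs_le.2 ⟨x.2.1.le, x.2.2.le⟩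

lemma continuous_atanh_coe : Continuous fun x : Int11 ↦ atanh (x : ℝ) := by
  unfold atanh
  refine Continuous.div_const (Continuous.log (Continuous.div (by fun_prop) (by fun_prop) ?_) ?_) 2
  · exact fun x ↦ x.one_sub_pos.ne'
  · exact fun x ↦ (div_pos x.one_add_pos x.one_sub_pos).ne'

lemma continuous_neg_log_one_sub_sq :
    Continuous fun x : Int11 ↦ -Real.log (1 - (x : ℝ) ^ 2) := by
  refine (Continuous.log (by fun_prop) fun x ↦ ?_).neg
  nlinarith [mul_pos x.one_add_pos x.one_sub_pos]

lemma log_one_sub_sq (x : Int11) :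
    Real.log (1 - (x : ℝ) ^ 2) = Real.log (1 + (x : ℝ)) + Real.log (1 - (x : ℝ)) := by
  rw [← Real.log_mul x.one_add_pos.ne' x.one_sub_pos.ne']
  ring_nf

lemma neg_log_one_sub_sq_nonneg (x : Int11) : 0 ≤ -Real.log (1 - (x : ℝ) ^ 2) := by
  have h : 0 < 1 - (x : ℝ) ^ 2 := by nlinarith [mul_pos x.one_add_pos x.one_sub_pos]
  linarith [Real.log_nonpos h.le (by nlinarith)]

lemma neg_log_one_sub_sq_le (x : Int11) :
    -Real.log (1 - (x : ℝ) ^ 2) ≤ 2 * |atanh (x : ℝ)| := by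
  have ha : 2 * atanh (x : ℝ) = Real.log (1 + (x : ℝ)) - Real.log (1 - (x : ℝ)) := by
    rw [atanh, Real.log_div x.one_add_pos.ne' x.one_sub_pos.ne']
    ring
  rw [log_one_sub_sq]
  rcases le_total 0 (x : ℝ) with h | h
  · linarith [le_abs_self (atanh (x : ℝ)), Real.log_nonneg (by linarith : 1 ≤ 1 + (x : ℝ))]
  · linarith [neg_abs_le (atanh (x : ℝ)), Real.log_nonneg (by linarith : 1 ≤ 1 - (x : ℝ))]

lemma ent_eq_binEntropy (x : ℝ) : ent x = Real.binEntropy ((1 + x) / 2) := by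
  rw [ent, Real.binEntropy, Real.log_inv, Real.log_inv,
    show 1 - (1 + x) / 2 = (1 - x) / 2 by ring]
  ring

lemma continuous_ent : Continuous ent := by
  rw [funext ent_eq_binEntropy]
  fun_prop

lemma abs_ent_le_one (x : Int11) : |ent (x : ℝ)| ≤ 1 := by
  rw [ent_eq_binEntropy, abs_of_nonneg]
  · linarith [Real.binEntropy_le_log_two (p := (1 + (x : ℝ)) / 2), Real.log_two_lt_d9]
  · exact Real.binEntropy_nonneg (by linarith [x.one_add_pos]) (by linarith [x.one_sub_pos])

/-- `log g` in closed form. -/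
lemma log_gdens (β lam φ q y : ℝ) (x : Int11) :
    Real.log (gdens β lam x φ q y) = -Real.log (1 - (x : ℝ) ^ 2) -
      (atanh x - β * lam * φ + β ^ 2 * (1 - q) * x - y * x) ^ 2 / (2 * β ^ 2 * q) := by
  have h : 0 < 1 - (x : ℝ) ^ 2 := by nlinarith [mul_pos x.one_add_pos x.one_sub_pos]
  rw [gdens, Real.log_mul (inv_pos.2 h).ne' (Real.exp_pos _).ne', Real.log_inv, Real.log_exp]
  ring

lemma continuous_log_gdens (β lam φ q y : ℝ) :
    Continuous fun x : Int11 ↦ Real.log (gdens β lam x φ q y) := by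
  simp_rw [log_gdens]
  have := continuous_neg_log_one_sub_sq
  have := continuous_atanh_coe
  fun_prop

/-- `log g` is bounded above by a constant minus a multiple of `arctanh²`. -/
lemma log_gdens_le {β lam η φ q y Y : ℝ} (hβ : 0 < β) (hlam : 0 ≤ lam) (hη : 0 < η)
    (hφ : |φ| ≤ 1) (hq : q ∈ Set.Icc η 1) (hy : |y| ≤ Y) (x : Int11) :
    Real.log (gdens β lam x φ q y) ≤
      8 * β ^ 2 + (β * lam + β ^ 2 + Y) ^ 2 / (2 * β ^ 2 * η) - atanh x ^ 2 / (8 * β ^ 2) := by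
  rw [log_gdens]
  set a := atanh (x : ℝ)
  obtain ⟨hq1, hq2⟩ := hq
  have hq0 : 0 < q := hη.trans_le hq1
  set B := β * lam + β ^ 2 + Y with hB
  have hY : 0 ≤ Y := (abs_nonneg y).trans hy
  have hb : |β * lam * φ - β ^ 2 * (1 - q) * x + y * x| ≤ B := by
    have h1 : |β * lam * φ| ≤ β * lam := by
      rw [abs_mul, abs_of_nonneg (by positivity)]
      exact mul_le_of_le_one_right (by positivity) hφ
    have h2 : |β ^ 2 * (1 - q) * x| ≤ β ^ 2 := by
      rw [abs_mul, abs_of_nonneg (mul_nonneg (by positivity) (by linarith))]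
      have : β ^ 2 * (1 - q) ≤ β ^ 2 := mul_le_of_le_one_right (by positivity) (by linarith)
      exact (mul_le_of_le_one_right (mul_nonneg (by positivity) (by linarith))
        x.abs_le_one).trans this
    have h3 : |y * x| ≤ Y := by
      rw [abs_mul]
      exact (mul_le_of_le_one_right (abs_nonneg _) x.abs_le_one).trans hy
    exact (abs_add_le _ _).trans (add_le_add ((abs_sub _ _).trans (add_le_add h1 h2)) h3)
  have hb2 : (β * lam * φ - β ^ 2 * (1 - q) * x + y * x) ^ 2 ≤ B ^ 2 :=
    sq_le_sq' (abs_le.1 hb).1 (abs_le.1 hb).2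
  have hsq : a ^ 2 / 2 - B ^ 2 ≤
      (a - β * lam * φ + β ^ 2 * (1 - q) * x - y * x) ^ 2 := by
    nlinarith [sq_nonneg (a - 2 * (β * lam * φ - β ^ 2 * (1 - q) * x + y * x))]
  have hden : (a ^ 2 / 2 - B ^ 2) / (2 * β ^ 2 * q) ≤
      (a - β * lam * φ + β ^ 2 * (1 - q) * x - y * x) ^ 2 / (2 * β ^ 2 * q) := by
    gcongr
  have h1 : a ^ 2 / (4 * β ^ 2) ≤ a ^ 2 / 2 / (2 * β ^ 2 * q) := by
    rw [div_div]
    refine div_le_div_of_nonneg_left (sq_nonneg a) (by positivity) ?_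
    nlinarith [mul_nonneg (sq_nonneg β) (sub_nonneg.2 hq2)]
  have h2 : B ^ 2 / (2 * β ^ 2 * q) ≤ B ^ 2 / (2 * β ^ 2 * η) := by gcongr
  have h3 : 2 * |a| ≤ 8 * β ^ 2 + a ^ 2 / (8 * β ^ 2) := by
    have : 8 * β ^ 2 + a ^ 2 / (8 * β ^ 2) - 2 * |a| =
        (|a| - 8 * β ^ 2) ^ 2 / (8 * β ^ 2) := by
      rw [← sq_abs a]
      field_simp
      ring
    have : 0 ≤ (|a| - 8 * β ^ 2) ^ 2 / (8 * β ^ 2) := by positivity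
    linarith
  have h4 : a ^ 2 / (4 * β ^ 2) = a ^ 2 / (8 * β ^ 2) + a ^ 2 / (8 * β ^ 2) := by
    ring
  rw [sub_div] at hden
  linarith [neg_log_one_sub_sq_le x]

end Hyperbolic

section Functionals

lemma abs_Mm_le_one (ρ : ProbabilityMeasure Int11) : |Mm ρ| ≤ 1 := by
  have h := norm_integral_le_of_norm_le_const (μ := (ρ : Measure Int11))
    (f := fun x : Int11 ↦ (x : ℝ)) (ae_of_all _ fun x ↦ Int11.abs_le_one x)
  simpa [Mm] using h

/-- A continuous function of at most linear growth in `arctanh` has its square dominated. -/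
lemma integrable_sq_of_le {ρ : ProbabilityMeasure Int11} {K : ℝ}
    (hρ : Integrable (fun x : Int11 ↦ atanh x ^ 2) (ρ : Measure Int11) ∧
      ∫ x, atanh (x : ℝ) ^ 2 ∂(ρ : Measure Int11) ≤ K)
    {f : Int11 → ℝ} (hf : Continuous f) (hfa : ∀ x : Int11, |f x| ≤ 1 + 2 * |atanh (x : ℝ)|) :
    Integrable (fun x ↦ f x ^ 2) (ρ : Measure Int11) ∧
      ∫ x, f x ^ 2 ∂(ρ : Measure Int11) ≤ 2 + 8 * K := by
  have hint : Integrable (fun x : Int11 ↦ 2 + 8 * atanh (x : ℝ) ^ 2) (ρ : Measure Int11) :=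
    (integrable_const _).add (hρ.1.const_mul 8)
  have hle (x : Int11) : f x ^ 2 ≤ 2 + 8 * atanh (x : ℝ) ^ 2 := by
    have h := sq_le_sq' (abs_le.1 (hfa x)).1 (abs_le.1 (hfa x)).2
    nlinarith [sq_nonneg (1 - 2 * |atanh (x : ℝ)|), sq_abs (atanh (x : ℝ))]
  have hfi : Integrable (fun x ↦ f x ^ 2) (ρ : Measure Int11) := by
    refine hint.mono' (hf.pow 2).aestronglyMeasurable (ae_of_all _ fun x ↦ ?_)
    rw [Real.norm_eq_abs, abs_of_nonneg (sq_nonneg _)]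
    exact hle x
  refine ⟨hfi, (integral_mono hfi hint hle).trans ?_⟩
  rw [integral_add (integrable_const _) (hρ.1.const_mul 8), integral_const_mul]
  simpa using hρ.2

/-- A lower bound on `J` controls the second moment of `arctanh`. -/
lemma integrable_atanh_sq_of_le_JE {β lam η Y : ℝ} (hβ : 0 < β) (hlam : 0 ≤ lam)
    (hη : 0 < η) (α : ℝ) :
    ∃ K : ℝ, ∀ (ρ : ProbabilityMeasure Int11) (y : ℝ), Qm ρ ∈ Set.Icc η 1 → |y| ≤ Y →
      -(α : EReal) ≤ JE β lam ρ y →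
      Integrable (fun x : Int11 ↦ atanh x ^ 2) (ρ : Measure Int11) ∧
        ∫ x, atanh (x : ℝ) ^ 2 ∂(ρ : Measure Int11) ≤ K := by
  set C := 8 * β ^ 2 + (β * lam + β ^ 2 + Y) ^ 2 / (2 * β ^ 2 * η) with hC
  have hC0 : 0 ≤ C := by positivity
  set c := β ^ 2 / 2 - Real.log (2 * π * β ^ 2 * η) / 2 with hc
  refine ⟨8 * β ^ 2 * (α + c + C + C), fun ρ y hQ hy hJ ↦ ?_⟩
  have hlog (x : Int11) : Real.log (gdens β lam x (Mm ρ) (Qm ρ) y) ≤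
      C - atanh x ^ 2 / (8 * β ^ 2) := log_gdens_le hβ hlam hη (abs_Mm_le_one ρ) hQ hy x
  set P := ∫⁻ x, ENNReal.ofReal (Real.log (gdens β lam x (Mm ρ) (Qm ρ) y)) ∂(ρ : Measure Int11)
    with hP
  set N := ∫⁻ x, ENNReal.ofReal (-Real.log (gdens β lam x (Mm ρ) (Qm ρ) y)) ∂(ρ : Measure Int11)
    with hN
  have hPC : P ≤ ENNReal.ofReal C := by
    calc P ≤ ∫⁻ _, ENNReal.ofReal C ∂(ρ : Measure Int11) := by
          refine lintegral_mono fun x ↦ ENNReal.ofReal_le_ofReal ((hlog x).trans ?_)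
          have : 0 ≤ atanh (x : ℝ) ^ 2 / (8 * β ^ 2) := by positivity
          linarith
      _ = ENNReal.ofReal C := by simp
  have hPtop : P ≠ ∞ := (hPC.trans_lt ENNReal.ofReal_lt_top).ne
  have hcQ : β ^ 2 * (1 - Qm ρ) ^ 2 / 2 - Real.log (2 * π * β ^ 2 * Qm ρ) / 2 ≤ c := by
    have h1 : (1 - Qm ρ) ^ 2 ≤ 1 := by nlinarith [hQ.1, hQ.2]
    have h2 : Real.log (2 * π * β ^ 2 * η) ≤ Real.log (2 * π * β ^ 2 * Qm ρ) :=
      Real.log_le_log (by positivity) (by gcongr; exact hQ.1)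
    nlinarith [sq_nonneg β]
  rw [JE, ← hP, ← hN] at hJ
  have hNtop : N ≠ ∞ := by
    intro h
    rw [h, ← EReal.coe_ennreal_toReal hPtop, EReal.coe_ennreal_top, ← EReal.coe_add,
      EReal.sub_top, ← EReal.coe_neg] at hJ
    exact EReal.coe_ne_bot _ (le_bot_iff.1 hJ)
  have hNle : N.toReal ≤ α + c + C := by
    rw [← EReal.coe_ennreal_toReal hPtop, ← EReal.coe_ennreal_toReal hNtop, ← EReal.coe_add,
      ← EReal.coe_sub, ← EReal.coe_neg, EReal.coe_le_coe_iff] at hJ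
    have := ENNReal.toReal_le_of_le_ofReal hC0 hPC
    linarith
  have hbound : ∫⁻ x, ENNReal.ofReal (atanh (x : ℝ) ^ 2 / (8 * β ^ 2)) ∂(ρ : Measure Int11) ≤
      ENNReal.ofReal (α + c + C + C) := by
    calc ∫⁻ x, ENNReal.ofReal (atanh (x : ℝ) ^ 2 / (8 * β ^ 2)) ∂(ρ : Measure Int11)
        ≤ ∫⁻ x, (ENNReal.ofReal (-Real.log (gdens β lam x (Mm ρ) (Qm ρ) y)) +
            ENNReal.ofReal C) ∂(ρ : Measure Int11) := by
          refine lintegral_mono fun x ↦ (ENNReal.ofReal_le_ofReal ?_).trans ENNReal.ofReal_add_le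
          linarith [hlog x]
      _ = N + ENNReal.ofReal C := by
          rw [lintegral_add_right _ measurable_const]
          simp [hN]
      _ = ENNReal.ofReal (N.toReal + C) := by
          rw [ENNReal.ofReal_add ENNReal.toReal_nonneg hC0, ENNReal.ofReal_toReal hNtop]
      _ ≤ ENNReal.ofReal (α + c + C + C) := ENNReal.ofReal_le_ofReal (by linarith)
  have hnn (x : Int11) : 0 ≤ atanh (x : ℝ) ^ 2 / (8 * β ^ 2) := by positivity
  have hint : Integrable (fun x : Int11 ↦ atanh (x : ℝ) ^ 2 / (8 * β ^ 2))
      (ρ : Measure Int11) := by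
    refine ⟨((continuous_atanh_coe.pow 2).div_const _).aestronglyMeasurable, ?_⟩
    rw [hasFiniteIntegral_iff_ofReal (ae_of_all _ hnn)]
    exact hbound.trans_lt ENNReal.ofReal_lt_top
  rw [← ofReal_integral_eq_lintegral_ofReal hint (ae_of_all _ hnn),
    ENNReal.ofReal_le_ofReal_iff (by linarith [ENNReal.toReal_nonneg (a := N)]),
    integral_div, div_le_iff₀ (by positivity)] at hbound
  refine ⟨?_, by linarith⟩
  refine (hint.mul_const (8 * β ^ 2)).congr (ae_of_all _ fun x ↦ ?_)
  field_simp

/-- The threshold such that `-α ≤ J(ρ, y)` says that the second moment of `arctanh` is at most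
the threshold. -/
def momentThreshold (β lam α : ℝ) (ρ : ProbabilityMeasure Int11) (y : ℝ) : ℝ :=
  2 * β ^ 2 * Qm ρ * (α + (β ^ 2 * (1 - Qm ρ) ^ 2 / 2 - Real.log (2 * π * β ^ 2 * Qm ρ) / 2) +
      ∫ x, -Real.log (1 - (x : ℝ) ^ 2) ∂(ρ : Measure Int11)) -
    ((β * lam * Mm ρ) ^ 2 + (β ^ 2 * (1 - Qm ρ) - y) ^ 2 * Qm ρ
      - 2 * (β * lam * Mm ρ) * ∫ x, atanh (x : ℝ) ∂(ρ : Measure Int11)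
      + 2 * (β ^ 2 * (1 - Qm ρ) - y) * Am ρ
      - 2 * (β * lam * Mm ρ) * (β ^ 2 * (1 - Qm ρ) - y) * Mm ρ)

lemma integrable_of_abs_le {ρ : ProbabilityMeasure Int11}
    (hρ : Integrable (fun x : Int11 ↦ atanh x ^ 2) (ρ : Measure Int11))
    {f : Int11 → ℝ} (hf : Continuous f) (hfa : ∀ x : Int11, |f x| ≤ 1 + 2 * |atanh (x : ℝ)|) :
    Integrable f (ρ : Measure Int11) :=
  integrable_of_integrable_sq ρ hf (integrable_sq_of_le ⟨hρ, le_rfl⟩ hf hfa).1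

lemma abs_mul_atanh_le (x : Int11) : |(x : ℝ) * atanh (x : ℝ)| ≤ |atanh (x : ℝ)| := by
  rw [abs_mul]
  exact mul_le_of_le_one_left (abs_nonneg _) x.abs_le_one

lemma abs_neg_log_one_sub_sq_le (x : Int11) :
    |-Real.log (1 - (x : ℝ) ^ 2)| ≤ 1 + 2 * |atanh (x : ℝ)| := by
  rw [abs_of_nonneg (neg_log_one_sub_sq_nonneg x)]
  linarith [neg_log_one_sub_sq_le x]

lemma integral_log_gdens {ρ : ProbabilityMeasure Int11}
    (hρ : Integrable (fun x : Int11 ↦ atanh x ^ 2) (ρ : Measure Int11)) (β lam φ q y : ℝ) :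
    Integrable (fun x : Int11 ↦ Real.log (gdens β lam x φ q y)) (ρ : Measure Int11) ∧
      ∫ x : Int11, Real.log (gdens β lam x φ q y) ∂(ρ : Measure Int11) =
        ∫ x, -Real.log (1 - (x : ℝ) ^ 2) ∂(ρ : Measure Int11) -
          (∫ x, atanh (x : ℝ) ^ 2 ∂(ρ : Measure Int11) +
            ((β * lam * φ) ^ 2 + (β ^ 2 * (1 - q) - y) ^ 2 * Qm ρ
              - 2 * (β * lam * φ) * ∫ x, atanh (x : ℝ) ∂(ρ : Measure Int11)
              + 2 * (β ^ 2 * (1 - q) - y) * Am ρ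
              - 2 * (β * lam * φ) * (β ^ 2 * (1 - q) - y) * Mm ρ)) / (2 * β ^ 2 * q) := by
  set s := β * lam * φ
  set t := β ^ 2 * (1 - q) - y with ht
  have iL := integrable_of_abs_le hρ continuous_neg_log_one_sub_sq abs_neg_log_one_sub_sq_le
  have iA1 := integrable_of_abs_le hρ continuous_atanh_coe
    fun x ↦ by linarith [abs_nonneg (atanh (x : ℝ))]
  have iA : Integrable (fun x : Int11 ↦ (x : ℝ) * atanh x) (ρ : Measure Int11) :=
    integrable_of_abs_le hρ (continuous_subtype_val.mul continuous_atanh_coe)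
    fun x ↦ by exact (abs_mul_atanh_le x).trans (by linarith [abs_nonneg (atanh (x : ℝ))])
  have iM := integrable_of_abs_le hρ continuous_subtype_val
    fun x ↦ by linarith [abs_nonneg (atanh (x : ℝ)), x.abs_le_one]
  have iQ : Integrable (fun x : Int11 ↦ (x : ℝ) ^ 2) (ρ : Measure Int11) := by
    refine integrable_of_abs_le hρ (continuous_subtype_val.pow 2) fun x ↦ ?_
    rw [abs_pow]
    nlinarith [abs_nonneg (atanh (x : ℝ)), x.abs_le_one, abs_nonneg (x : ℝ)]
  have heq (x : Int11) : Real.log (gdens β lam x φ q y) = -Real.log (1 - (x : ℝ) ^ 2) -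
      (atanh x ^ 2 + (s ^ 2 + t ^ 2 * (x : ℝ) ^ 2 - 2 * s * atanh x + 2 * t * (x * atanh x)
        - 2 * s * t * x)) / (2 * β ^ 2 * q) := by
    rw [log_gdens, ht]
    ring
  simp_rw [heq]
  have i1 := (integrable_const (μ := (ρ : Measure Int11)) (s ^ 2)).add (iQ.const_mul (t ^ 2))
  have i2 := i1.sub (iA1.const_mul (2 * s))
  have i3 := i2.add (iA.const_mul (2 * t))
  have i4 := i3.sub (iM.const_mul (2 * s * t))
  have i5 := (hρ.add i4).div_const (2 * β ^ 2 * q)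
  refine ⟨iL.sub i5, (integral_sub iL i5).trans ?_⟩
  congr 1
  refine (integral_div _ _).trans ?_
  congr 1
  refine (integral_add hρ i4).trans ?_
  congr 1
  refine (integral_sub i3 (iM.const_mul _)).trans ?_
  refine congrArg₂ _ ((integral_add i2 (iA.const_mul _)).trans ?_) (integral_const_mul _ _)
  refine congrArg₂ _ ((integral_sub i1 (iA1.const_mul _)).trans ?_) (integral_const_mul _ _)
  refine congrArg₂ _ ((integral_add (integrable_const _) (iQ.const_mul _)).trans ?_)
    (integral_const_mul _ _)
  refine congrArg₂ _ (by simp) (integral_const_mul _ _)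

lemma neg_le_JE_iff {β : ℝ} (lam : ℝ) (hβ : 0 < β) {ρ : ProbabilityMeasure Int11}
    (hQ : 0 < Qm ρ) (hρ : Integrable (fun x : Int11 ↦ atanh x ^ 2) (ρ : Measure Int11))
    (α y : ℝ) :
    -(α : EReal) ≤ JE β lam ρ y ↔
      ∫ x, atanh (x : ℝ) ^ 2 ∂(ρ : Measure Int11) ≤ momentThreshold β lam α ρ y := by
  obtain ⟨hi, he⟩ := integral_log_gdens hρ β lam (Mm ρ) (Qm ρ) y
  have hPtop := (lintegral_ofReal_le_lintegral_enorm
    (μ := (ρ : Measure Int11)) fun x : Int11 ↦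
      Real.log (gdens β lam x (Mm ρ) (Qm ρ) y)).trans_lt hi.2 |>.ne
  have hNtop := (lintegral_ofReal_le_lintegral_enorm
    (μ := (ρ : Measure Int11)) fun x : Int11 ↦
      -Real.log (gdens β lam x (Mm ρ) (Qm ρ) y)).trans_lt hi.neg.2 |>.ne
  rw [integral_eq_lintegral_pos_part_sub_lintegral_neg_part hi] at he
  rw [JE, ← EReal.coe_ennreal_toReal hPtop, ← EReal.coe_ennreal_toReal hNtop, ← EReal.coe_add,
    ← EReal.coe_sub, ← EReal.coe_neg, EReal.coe_le_coe_iff, add_sub_assoc, he, momentThreshold]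
  have key (c L V R D : ℝ) (hD : 0 < D) :
      -α ≤ c + (L - (V + R) / D) ↔ V ≤ D * (α + c + L) - R := by
    rw [show -α ≤ c + (L - (V + R) / D) ↔ (V + R) / D ≤ α + c + L by
      constructor <;> intro h <;> linarith, div_le_iff₀ hD]
    constructor <;> intro h <;> linarith
  exact key _ _ _ _ _ (by positivity)

variable {ι : Type*} {F : Filter ι} {μs : ι → ProbabilityMeasure Int11}
  {μ : ProbabilityMeasure Int11}

lemma tendsto_Qm (hμ : Tendsto μs F (nhds μ)) :
    Tendsto (fun i ↦ Qm (μs i)) F (nhds (Qm μ)) :=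
  tendsto_integral_of_bounded hμ (by fun_prop) 1 fun x ↦ by
    rw [abs_pow]
    exact pow_le_one₀ (abs_nonneg _) x.abs_le_one

lemma tendsto_Mm (hμ : Tendsto μs F (nhds μ)) :
    Tendsto (fun i ↦ Mm (μs i)) F (nhds (Mm μ)) :=
  tendsto_integral_of_bounded hμ (by fun_prop) 1 Int11.abs_le_one

/-- With bounded second moments of `arctanh`, integrals of continuous functions of at most linear
growth in `arctanh` converge. -/
lemma tendsto_integral_of_abs_le [F.NeBot] (hμ : Tendsto μs F (nhds μ)) {K : ℝ}
    (hK : ∀ᶠ i in F, Integrable (fun x : Int11 ↦ atanh x ^ 2) (μs i : Measure Int11) ∧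
      ∫ x, atanh (x : ℝ) ^ 2 ∂(μs i : Measure Int11) ≤ K)
    {f : Int11 → ℝ} (hf : Continuous f) (hfa : ∀ x : Int11, |f x| ≤ 1 + 2 * |atanh (x : ℝ)|) :
    Tendsto (fun i ↦ ∫ x, f x ∂(μs i : Measure Int11)) F
      (nhds (∫ x, f x ∂(μ : Measure Int11))) :=
  tendsto_integral_of_sq_bounded hμ hf (hK.mono fun _ hi ↦ integrable_sq_of_le hi hf hfa)

end Functionals

/-- **Lemma B.4.** For closed `U ⊆ [η,1] × ℝ³` and any `α < ∞`, the set
`Ξ(α) = {(ρ,y) : (Q(ρ),M(ρ),A(ρ),E(ρ)) ∈ U, J(ρ,y) ≥ −α}` is closed in `P × ℝ`. -/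
theorem Xi_closed (β lam η : ℝ) (hβ : 0 < β) (hlam : 0 ≤ lam)
    (hη : η ∈ Set.Ioo (0 : ℝ) 1)
    (U : Set (ℝ × ℝ × ℝ × ℝ)) (hU : IsClosed U)
    (hUsub : ∀ p ∈ U, p.1 ∈ Set.Icc η 1) (α : ℝ) :
    IsClosed {p : ProbabilityMeasure Int11 × ℝ |
      (Qm p.1, Mm p.1, Am p.1, Em β p.1) ∈ U ∧ -(α : EReal) ≤ JE β lam p.1 p.2} := by
  refine isClosed_of_closure_subset fun p₀ hp₀ ↦ ?_
  set S := {p : ProbabilityMeasure Int11 × ℝ |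
      (Qm p.1, Mm p.1, Am p.1, Em β p.1) ∈ U ∧ -(α : EReal) ≤ JE β lam p.1 p.2} with hS
  have hne : (nhdsWithin p₀ S).NeBot := mem_closure_iff_nhdsWithin_neBot.1 hp₀
  set F := nhdsWithin p₀ S
  have hmem : ∀ᶠ p in F, p ∈ S := self_mem_nhdsWithin
  have hρ : Tendsto (fun p : ProbabilityMeasure Int11 × ℝ ↦ p.1) F (nhds p₀.1) :=
    (continuous_fst.tendsto p₀).mono_left nhdsWithin_le_nhds
  have hy : Tendsto (fun p : ProbabilityMeasure Int11 × ℝ ↦ p.2) F (nhds p₀.2) :=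
    (continuous_snd.tendsto p₀).mono_left nhdsWithin_le_nhds
  have hybd : ∀ᶠ p in F, |p.2| ≤ |p₀.2| + 1 :=
    hy.abs.eventually_le_const (lt_add_one _)
  obtain ⟨K, hK⟩ := integrable_atanh_sq_of_le_JE (Y := |p₀.2| + 1) hβ hlam hη.1 α
  have hKF : ∀ᶠ p in F, Integrable (fun x : Int11 ↦ atanh x ^ 2) (p.1 : Measure Int11) ∧
      ∫ x, atanh (x : ℝ) ^ 2 ∂(p.1 : Measure Int11) ≤ K := by
    filter_upwards [hmem, hybd] with p hp hpy
    exact hK p.1 p.2 (hUsub _ hp.1) hpy hp.2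
  have hQ := tendsto_Qm hρ
  have hM := tendsto_Mm hρ
  have hA : Tendsto (fun p : ProbabilityMeasure Int11 × ℝ ↦ Am p.1) F (nhds (Am p₀.1)) := by
    refine tendsto_integral_of_abs_le hρ hKF
      (continuous_subtype_val.mul continuous_atanh_coe) fun x ↦ ?_
    exact (abs_mul_atanh_le x).trans (by linarith [abs_nonneg (atanh (x : ℝ))])
  have hA1 := tendsto_integral_of_abs_le hρ hKF continuous_atanh_coe
    fun x ↦ by linarith [abs_nonneg (atanh (x : ℝ))]
  have hL := tendsto_integral_of_abs_le hρ hKF continuous_neg_log_one_sub_sq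
    abs_neg_log_one_sub_sq_le
  have hE : Tendsto (fun p : ProbabilityMeasure Int11 × ℝ ↦ Em β p.1) F (nhds (Em β p₀.1)) := by
    refine (tendsto_integral_of_abs_le hρ hKF
      (f := fun x ↦ ent (x : ℝ) + (x : ℝ) * atanh (x : ℝ) / 2) ?_ fun x ↦ ?_).neg.sub
      (((hQ.pow 2).const_sub 1).const_mul _)
    · exact (continuous_ent.comp continuous_subtype_val).add
        ((continuous_subtype_val.mul continuous_atanh_coe).div_const 2)
    · refine (abs_add_le _ _).trans (add_le_add (abs_ent_le_one x) ?_)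
      rw [abs_div, abs_two]
      linarith [abs_mul_atanh_le x, abs_nonneg (atanh (x : ℝ))]
  have hU₀ : (Qm p₀.1, Mm p₀.1, Am p₀.1, Em β p₀.1) ∈ U :=
    hU.mem_of_tendsto (hQ.prodMk_nhds (hM.prodMk_nhds (hA.prodMk_nhds hE)))
      (hmem.mono fun p hp ↦ hp.1)
  have hQ₀ : 0 < Qm p₀.1 := hη.1.trans_le (hUsub _ hU₀).1
  have hV₀ := integrable_and_integral_le_of_tendsto hρ (continuous_atanh_coe.pow 2)
    (fun x ↦ sq_nonneg _) hKF
  refine ⟨hU₀, (neg_le_JE_iff lam hβ hQ₀ hV₀.1 α p₀.2).2 (le_of_forall_pos_le_add fun ε hε ↦ ?_)⟩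
  have hT : Tendsto (fun p : ProbabilityMeasure Int11 × ℝ ↦ momentThreshold β lam α p.1 p.2) F
      (nhds (momentThreshold β lam α p₀.1 p₀.2)) := by
    have hlog := ((hQ.const_mul (2 * π * β ^ 2)).log (by positivity)).div_const 2
    have hc := ((((hQ.const_sub 1).pow 2).const_mul (β ^ 2)).div_const 2).sub hlog
    have hs := hM.const_mul (β * lam)
    have ht := ((hQ.const_sub 1).const_mul (β ^ 2)).sub hy
    exact ((hQ.const_mul (2 * β ^ 2)).mul ((hc.const_add α).add hL)).sub
      (((((hs.pow 2).add ((ht.pow 2).mul hQ)).sub ((hs.const_mul 2).mul hA1)).add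
        ((ht.const_mul 2).mul hA)).sub (((hs.const_mul 2).mul ht).mul hM))
  refine (integrable_and_integral_le_of_tendsto hρ (continuous_atanh_coe.pow 2)
    (fun x ↦ sq_nonneg _) ?_).2
  filter_upwards [hmem, hKF, hT.eventually_le_const (lt_add_of_pos_right _ hε)] with p hp hpK hpT
  exact ⟨hpK.1, ((neg_le_JE_iff lam hβ (hη.1.trans_le (hUsub _ hp.1).1) hpK.1 α p.2).1 hp.2).trans
    hpT⟩

end
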